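/- Let n ≥ 1, s ∈ ℝ, σ > s, and let η ∈ C_c^∞(ℝⁿ). Then there exist θ ∈ (0,1) and C > 0 (depending on n, s, σ, η) such that for every f ∈ L¹(ℝⁿ) with ∑_{k ∈ ℤⁿ} (1+|k|)^σ ‖□_k f‖_{L¹} < ∞, one has ∑_{k ∈ ℤⁿ} (1+|k|)^s ‖□_k f‖_{L¹(ℝⁿ)} ≤ C ( ∑_{k ∈ ℤⁿ} (1+|k|)^σ ‖□_k f‖_{L¹(ℝⁿ)} )^{1-θ} ‖f‖_{L¹(ℝⁿ)}^θ. -/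

import Mathlib

open MeasureTheory

noncomputable section

/-- `e r = exp (i r)`. -/
def e (r : ℝ) : ℂ := Complex.exp (Complex.I * (r : ℂ))

/-- `⟨k⟩ = 1 + |k|` with the Euclidean norm of `k ∈ ℤⁿ`. -/
def jpn {n : ℕ} (k : Fin n → ℤ) : ℝ := 1 + Real.sqrt (∑ j, ((k j : ℝ)) ^ 2)

/-- The frequency-uniform decomposition operator `□_k f = (𝓕⁻¹ η(· - k)) * f`,
convolution of `f` with the inverse Fourier transform of the translated window
`η(· - k)`. -/
def Box {n : ℕ} (η : (Fin n → ℝ) → ℂ) (k : Fin n → ℤ) (f : (Fin n → ℝ) → ℂ)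
    (x : Fin n → ℝ) : ℂ :=
  ∫ y : Fin n → ℝ,
    (((2 * Real.pi) ^ n)⁻¹ •
        ∫ ξ : Fin n → ℝ, e (∑ j, (x j - y j) * ξ j) * η (fun j => ξ j - (k j : ℝ))) * f y

/-- Hölder interpolation between a weighted `ℓ¹` norm and a uniform bound. -/
theorem tsum_rpow_mul_le_of_le {ι : Type*} {w a : ι → ℝ} {s σ θ A : ℝ}
    (hw : ∀ i, 0 < w i) (ha : ∀ i, 0 ≤ a i) (haA : ∀ i, a i ≤ A)
    (hθ : θ ∈ Set.Ioo (0 : ℝ) 1)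
    (hsum_w : Summable fun i => w i ^ ((s - σ * (1 - θ)) / θ))
    (hsum_a : Summable fun i => w i ^ σ * a i) :
    ∑' i, w i ^ s * a i ≤
      (∑' i, w i ^ ((s - σ * (1 - θ)) / θ)) ^ θ * (∑' i, w i ^ σ * a i) ^ (1 - θ) * A ^ θ := by
  obtain ⟨hθ₀, hθ₁⟩ := hθ
  have hθ' : 0 < 1 - θ := by linarith
  have hpq : (θ⁻¹).HolderConjugate (1 - θ)⁻¹ := by
    rw [Real.holderConjugate_iff]
    exact ⟨(one_lt_inv₀ hθ₀).2 hθ₁, by simp⟩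
  have hwa : ∀ i, 0 ≤ w i ^ σ * a i := fun i => mul_nonneg (Real.rpow_nonneg (hw i).le _) (ha i)
  have hp : ∀ i, (w i ^ (s - σ * (1 - θ))) ^ θ⁻¹ = w i ^ ((s - σ * (1 - θ)) / θ) := fun i => by
    rw [← Real.rpow_mul (hw i).le, div_eq_mul_inv]
  have hq : ∀ i, ((w i ^ σ * a i) ^ (1 - θ)) ^ (1 - θ)⁻¹ = w i ^ σ * a i := fun i =>
    Real.rpow_rpow_inv (hwa i) hθ'.ne'
  obtain ⟨hsum, hle⟩ := Real.summable_and_inner_le_Lp_mul_Lq_tsum_of_nonneg hpq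
    (f := fun i => w i ^ (s - σ * (1 - θ))) (g := fun i => (w i ^ σ * a i) ^ (1 - θ))
    (fun i => Real.rpow_nonneg (hw i).le _) (fun i => Real.rpow_nonneg (hwa i) _)
    (by simpa only [hp] using hsum_w) (by simpa only [hq] using hsum_a)
  simp only [hp, hq, one_div, inv_inv] at hle
  have hterm : ∀ i, w i ^ s * a i ≤
      w i ^ (s - σ * (1 - θ)) * (w i ^ σ * a i) ^ (1 - θ) * A ^ θ := fun i => by
    have hsplit : w i ^ s * a i =
        w i ^ (s - σ * (1 - θ)) * (w i ^ σ * a i) ^ (1 - θ) * a i ^ θ := by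
      rw [Real.mul_rpow (Real.rpow_nonneg (hw i).le _) (ha i), ← Real.rpow_mul (hw i).le,
        ← mul_assoc, ← Real.rpow_add (hw i), mul_assoc,
        ← Real.rpow_add_of_nonneg (ha i) hθ'.le hθ₀.le]
      simp
    rw [hsplit]
    exact mul_le_mul_of_nonneg_left (Real.rpow_le_rpow (ha i) (haA i) hθ₀.le)
      (mul_nonneg (Real.rpow_nonneg (hw i).le _) (Real.rpow_nonneg (hwa i) _))
  have hsum' := hsum.mul_right (A ^ θ)
  have hsum_s : Summable fun i => w i ^ s * a i :=
    .of_nonneg_of_le (fun i => mul_nonneg (Real.rpow_nonneg (hw i).le _) (ha i)) hterm hsum'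
  rcases isEmpty_or_nonempty ι with h | ⟨⟨i₀⟩⟩
  · simp [Real.zero_rpow hθ₀.ne']
  have hA : 0 ≤ A := (ha i₀).trans (haA i₀)
  calc ∑' i, w i ^ s * a i
      ≤ ∑' i, w i ^ (s - σ * (1 - θ)) * (w i ^ σ * a i) ^ (1 - θ) * A ^ θ :=
        hsum_s.tsum_le_tsum hterm hsum'
    _ = (∑' i, w i ^ (s - σ * (1 - θ)) * (w i ^ σ * a i) ^ (1 - θ)) * A ^ θ := tsum_mul_right
    _ ≤ _ := mul_le_mul_of_nonneg_right hle (Real.rpow_nonneg hA _)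

theorem one_le_jpn {n : ℕ} (k : Fin n → ℤ) : 1 ≤ jpn k :=
  le_add_of_nonneg_right (Real.sqrt_nonneg _)

theorem summable_jpn_rpow {n : ℕ} {r : ℝ} (hr : r < -n) :
    Summable fun k : Fin n → ℤ => jpn k ^ r := by
  have hr₀ : r ≤ 0 := hr.le.trans (by simp)
  let b := Pi.basisFun ℝ (Fin n)
  let L : Submodule ℤ (Fin n → ℝ) := Submodule.span ℤ (Set.range b)
  have hmem : ∀ k : Fin n → ℤ, (fun j => (k j : ℝ)) ∈ L := fun k => by
    refine (b.mem_span_iff_repr_mem ℤ _).2 fun i => ?_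
    simp [b]
  let φ : (Fin n → ℤ) → L := fun k => ⟨fun j => (k j : ℝ), hmem k⟩
  have hφ : Function.Injective φ := fun k l h => by
    ext j
    simpa [φ] using congrFun (congrArg Subtype.val h) j
  have hrank : Module.finrank ℤ L = n := by
    rw [ZLattice.rank ℝ L]; simp
  have hL : Summable fun k => ‖φ k‖ ^ r :=
    (ZLattice.summable_norm_rpow L r (by rwa [hrank])).comp_injective hφ
  refine Summable.of_norm_bounded_eventually hL ?_
  filter_upwards [(Set.finite_singleton (0 : Fin n → ℤ)).compl_mem_cofinite] with k hk
  have hpos : 0 < ‖φ k‖ := norm_pos_iff.2 fun h => hk <| hφ <| h.trans (by ext; simp [φ])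
  rw [Real.norm_of_nonneg (Real.rpow_nonneg (zero_le_one.trans (one_le_jpn k)) _)]
  refine Real.rpow_le_rpow_of_nonpos hpos ?_ hr₀
  refine (pi_norm_le_iff_of_nonneg (zero_le_one.trans (one_le_jpn k))).2 fun j => ?_
  have : ‖(k j : ℝ)‖ ≤ Real.sqrt (∑ j, (k j : ℝ) ^ 2) :=
    Real.abs_le_sqrt
      (Finset.single_le_sum (f := fun j => (k j : ℝ) ^ 2) (fun _ _ => sq_nonneg _)
        (Finset.mem_univ j))
  exact this.trans (le_add_of_nonneg_left zero_le_one)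

theorem norm_e (r : ℝ) : ‖e r‖ = 1 := by
  rw [e, mul_comm, Complex.norm_exp_ofReal_mul_I]

theorem e_add (a b : ℝ) : e (a + b) = e a * e b := by
  simp [e, mul_add, Complex.exp_add]

/-- The inverse Fourier integral of a test function, without the factor `(2π)⁻ⁿ`, is integrable. -/
theorem integrable_integral_e_mul {n : ℕ} {η : (Fin n → ℝ) → ℂ}
    (hη : ContDiff ℝ (⊤ : ℕ∞) η) (hηc : HasCompactSupport η) :
    Integrable fun x : Fin n → ℝ => ∫ ξ : Fin n → ℝ, e (∑ j, x j * ξ j) * η ξ := by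
  let E := EuclideanSpace.equiv (Fin n) ℝ
  let g : SchwartzMap (EuclideanSpace ℝ (Fin n)) ℂ :=
    (hηc.comp_homeomorph E.toHomeomorph).toSchwartzMap (hη.comp E.contDiff)
  have hint : Integrable (FourierTransformInv.fourierInv g : SchwartzMap _ ℂ) :=
    SchwartzMap.integrable _
  have hint' := ((PiLp.volume_preserving_toLp (Fin n)).integrable_comp_emb
    (MeasurableEquiv.toLp 2 (Fin n → ℝ)).measurableEmbedding).2 hint
  refine (hint'.comp_smul (inv_ne_zero Real.two_pi_pos.ne')).congr (.of_forall fun x => ?_)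
  symm
  beta_reduce
  rw [Function.comp_apply, SchwartzMap.fourierInv_coe, Real.fourierInv_eq',
    ← (PiLp.volume_preserving_toLp (Fin n)).integral_comp
      (MeasurableEquiv.toLp 2 (Fin n → ℝ)).measurableEmbedding]
  refine integral_congr_ae (.of_forall fun ξ => ?_)
  have hinner : 2 * Real.pi * inner ℝ (WithLp.toLp 2 ξ) (WithLp.toLp 2 ((2 * Real.pi)⁻¹ • x)) =
      ∑ j, x j * ξ j := by
    rw [WithLp.toLp_smul, inner_smul_right, mul_inv_cancel_left₀ Real.two_pi_pos.ne']
    simp [PiLp.inner_apply]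
  have hg : g (WithLp.toLp 2 ξ) = η ξ := rfl
  simp only [hinner, hg, e, smul_eq_mul, mul_comm Complex.I]

theorem norm_integral_e_mul_translate {n : ℕ} (η : (Fin n → ℝ) → ℂ) (k : Fin n → ℤ)
    (x : Fin n → ℝ) :
    ‖∫ ξ : Fin n → ℝ, e (∑ j, x j * ξ j) * η (fun j => ξ j - (k j : ℝ))‖ =
      ‖∫ ξ : Fin n → ℝ, e (∑ j, x j * ξ j) * η ξ‖ := by
  rw [← integral_add_right_eq_self _ (fun j => (k j : ℝ))]
  simp only [Pi.add_apply, mul_add, Finset.sum_add_distrib, e_add, add_sub_cancel_right,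
    mul_right_comm _ (e (∑ j, x j * (k j : ℝ)))]
  rw [integral_mul_const, norm_mul, norm_e, mul_one]

open scoped Convolution in
/-- `□_k` is bounded on `L¹` uniformly in `k`. -/
theorem integral_norm_Box_le {n : ℕ} {η : (Fin n → ℝ) → ℂ}
    (hη : ContDiff ℝ (⊤ : ℕ∞) η) (hηc : HasCompactSupport η) (k : Fin n → ℤ)
    {f : (Fin n → ℝ) → ℂ} (hf : Integrable f) :
    ∫ x, ‖Box η k f x‖ ≤
      (((2 * Real.pi) ^ n)⁻¹ *
        ∫ x : Fin n → ℝ, ‖∫ ξ : Fin n → ℝ, e (∑ j, x j * ξ j) * η ξ‖) * ∫ x, ‖f x‖ := by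
  let G : (Fin n → ℝ) → ℝ := fun x =>
    ((2 * Real.pi) ^ n)⁻¹ * ‖∫ ξ : Fin n → ℝ, e (∑ j, x j * ξ j) * η ξ‖
  have hG : Integrable G := (integrable_integral_e_mul hη hηc).norm.const_mul _
  have hB : ∀ x, ‖Box η k f x‖ ≤
      ((fun y => ‖f y‖) ⋆[ContinuousLinearMap.mul ℝ ℝ, volume] G) x := fun x => by
    refine (norm_integral_le_integral_norm _).trans_eq
      (integral_congr_ae (.of_forall fun y => ?_))
    have := norm_integral_e_mul_translate η k (x - y)
    simp only [Pi.sub_apply] at this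
    have hpos : 0 ≤ ((2 * Real.pi) ^ n)⁻¹ := by positivity
    simp only [norm_mul, norm_smul, this, Real.norm_of_nonneg hpos, G, Pi.sub_apply,
      ContinuousLinearMap.mul_apply']
    exact mul_comm _ _
  calc ∫ x, ‖Box η k f x‖
      ≤ ∫ x, ((fun y => ‖f y‖) ⋆[ContinuousLinearMap.mul ℝ ℝ, volume] G) x :=
        integral_mono_of_nonneg (.of_forall fun _ => norm_nonneg _)
          (hf.norm.integrable_convolution _ hG) (.of_forall hB)
    _ = _ := by
        rw [integral_convolution _ hf.norm hG, ContinuousLinearMap.mul_apply', mul_comm]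
        simp only [G, integral_const_mul]

/-- interpolation inequality between weighted `M^s_{1,1}`-type
modulation norms (built from the window `η ∈ C_c^∞(ℝⁿ)`) and the `L¹` norm. -/
theorem stmt_19 (n : ℕ) (hn : 1 ≤ n) (s σ : ℝ) (hsσ : s < σ)
    (η : (Fin n → ℝ) → ℂ) (hη : ContDiff ℝ (⊤ : ℕ∞) η) (hηc : HasCompactSupport η) :
    ∃ θ : ℝ, θ ∈ Set.Ioo (0 : ℝ) 1 ∧
      ∃ C : ℝ, 0 < C ∧
        ∀ f : (Fin n → ℝ) → ℂ,
          Integrable f →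
          Summable (fun k : Fin n → ℤ =>
            jpn k ^ σ * ∫ x : Fin n → ℝ, ‖Box η k f x‖) →
          (∑' k : Fin n → ℤ, jpn k ^ s * ∫ x : Fin n → ℝ, ‖Box η k f x‖)
            ≤ C * (∑' k : Fin n → ℤ,
                  jpn k ^ σ * ∫ x : Fin n → ℝ, ‖Box η k f x‖) ^ (1 - θ) *
                (∫ x : Fin n → ℝ, ‖f x‖) ^ θ := by
  set K : ℝ := ((2 * Real.pi) ^ n)⁻¹ *
    ∫ x : Fin n → ℝ, ‖∫ ξ : Fin n → ℝ, e (∑ j, x j * ξ j) * η ξ‖ with hK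
  have hK₀ : 0 ≤ K := mul_nonneg (by positivity) (integral_nonneg fun _ => norm_nonneg _)
  have hδ : 0 < σ - s := sub_pos.2 hsσ
  have hD : 0 < σ - s + |σ| + n + 1 := by positivity
  set θ : ℝ := (σ - s) / (σ - s + |σ| + n + 1)
  have hθ₀ : 0 < θ := div_pos hδ hD
  have hθ₁ : θ < 1 := (div_lt_one hD).2 (by linarith [abs_nonneg σ, n.cast_nonneg (α := ℝ)])
  have hr : (s - σ * (1 - θ)) / θ < -n := by
    rw [div_lt_iff₀ hθ₀]
    have hθD : θ * (σ - s + |σ| + n + 1) = σ - s := div_mul_cancel₀ _ hD.ne'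
    nlinarith [mul_le_mul_of_nonneg_left (le_abs_self σ) hθ₀.le, mul_pos hθ₀ hδ]
  have hS := summable_jpn_rpow hr
  have hpos : ∀ k : Fin n → ℤ, 0 < jpn k := fun k => zero_lt_one.trans_le (one_le_jpn k)
  set S := ∑' k : Fin n → ℤ, jpn k ^ ((s - σ * (1 - θ)) / θ)
  have hS₀ : 0 ≤ S := tsum_nonneg fun k => Real.rpow_nonneg (hpos k).le _
  refine ⟨θ, ⟨hθ₀, hθ₁⟩, S ^ θ * K ^ θ + 1, by positivity, fun f hf hsum => ?_⟩
  have hf₀ : 0 ≤ ∫ x, ‖f x‖ := integral_nonneg fun _ => norm_nonneg _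
  have hbox : ∀ k, 0 ≤ ∫ x, ‖Box η k f x‖ := fun k => integral_nonneg fun _ => norm_nonneg _
  have hT : 0 ≤ ∑' k, jpn k ^ σ * ∫ x, ‖Box η k f x‖ :=
    tsum_nonneg fun k => mul_nonneg (Real.rpow_nonneg (hpos k).le _) (hbox k)
  refine (tsum_rpow_mul_le_of_le hpos hbox
    (fun k => integral_norm_Box_le hη hηc k hf) ⟨hθ₀, hθ₁⟩ hS hsum).trans ?_
  rw [← hK, Real.mul_rpow hK₀ hf₀]
  calc _ = S ^ θ * K ^ θ * (∑' k, jpn k ^ σ * ∫ x, ‖Box η k f x‖) ^ (1 - θ) *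
        (∫ x, ‖f x‖) ^ θ := by ring
    _ ≤ _ := by gcongr; linarith
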